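/- Higher order Stein identity (score functions yield higher order differential operators): Let x ∈ R^{d_x} be a random vector with density p(x), and suppose the m-th order score function S_m(x) = (−1)^m ∇_x^{(m)} p(x) / p(x) exists. Let G : R^{d_x} → ⊗^r R^{d_y} be a continuously differentiable (m times) tensor-valued function such that for each i ∈ {0, 1, …, m−1}, all entries of ∇_x^{(i)} G(x) ⊗ S_{m−i−1}(x) · p(x) tend to zero on the boundary of the support of p(x), and all expectations below exist. Then E[G(x) ⊗ S_m(x)] = E[∇_x^{(m)} G(x)]. -/

import Mathlib

open MeasureTheory Filter

/-- The `m`-th order score function `S_m(x) = (−1)^m ∇ₓ^{(m)} p(x) / p(x)` of a density `p` on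
`ℝ^d`, represented entrywise: an order-`m` tensor is a function `(Fin m → Fin d) → ℝ`. -/
noncomputable def scoreFun {d : ℕ} (p : EuclideanSpace ℝ (Fin d) → ℝ) (m : ℕ)
    (x : EuclideanSpace ℝ (Fin d)) (idx : Fin m → Fin d) : ℝ :=
  (-1 : ℝ) ^ m *
    iteratedFDeriv ℝ m p x (fun k => EuclideanSpace.single (idx k) 1) / p x

/-- The iterated derivative of a `C^n` real function is symmetric. -/
theorem ContDiff.iteratedFDeriv_comp_swap {E F : Type*} [NormedAddCommGroup E] [NormedSpace ℝ E]
    [NormedAddCommGroup F] [NormedSpace ℝ F] {f : E → F} {n : ℕ} (hf : ContDiff ℝ (n + 1 : ℕ) f)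
    (i : Fin n) (x : E) (v : Fin (n + 1) → E) :
    iteratedFDeriv ℝ (n + 1) f x (v ∘ Equiv.swap i.castSucc i.succ)
      = iteratedFDeriv ℝ (n + 1) f x v := by
  induction n generalizing x with
  | zero => exact i.elim0
  | succ n ih =>
    induction i using Fin.cases with
    | zero =>
      set h : E → E [×n]→L[ℝ] F := iteratedFDeriv ℝ n f with hh
      have h2 : ContDiff ℝ 2 h := hf.iteratedFDeriv_right (by norm_cast; omega)
      have hsymm : IsSymmSndFDerivAt ℝ h x := h2.contDiffAt.isSymmSndFDerivAt (by simp)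
      have hd : Differentiable ℝ (fderiv ℝ h) :=
        (h2.fderiv_right (m := 1) (by norm_num)).differentiable (by norm_num)
      have key (w : Fin (n + 2) → E) : iteratedFDeriv ℝ (n + 2) f x w
          = fderiv ℝ (fderiv ℝ h) x (w 0) (w 1) (fun k => w k.succ.succ) := by
        have hfun (u : Fin (n + 1) → E) : (fun y => iteratedFDeriv ℝ (n + 1) f y u)
            = fun y => fderiv ℝ h y (u 0) (Fin.tail u) := by
          ext y
          rw [iteratedFDeriv_succ_apply_left]
        have hdiff : DifferentiableAt ℝ (iteratedFDeriv ℝ (n + 1) f) x :=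
          (hf.differentiable_iteratedFDeriv (by norm_cast; omega)) x
        rw [iteratedFDeriv_succ_apply_left]
        have h1 : fderiv ℝ (iteratedFDeriv ℝ (n + 1) f) x (w 0) (Fin.tail w)
            = fderiv ℝ (fun y => iteratedFDeriv ℝ (n + 1) f y (Fin.tail w)) x (w 0) := by
          rw [fderiv_continuousMultilinear_apply_const_apply hdiff]
        rw [h1, hfun, fderiv_continuousMultilinear_apply_const_apply
          ((hd x).clm_apply (differentiableAt_const _)),
          fderiv_clm_apply (hd x) (differentiableAt_const _)]
        simp [Fin.tail_def]
      rw [key, key]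
      have e0 : (v ∘ Equiv.swap (Fin.castSucc (0 : Fin (n + 1))) (Fin.succ 0)) 0 = v 1 := by simp
      have e1 : (v ∘ Equiv.swap (Fin.castSucc (0 : Fin (n + 1))) (Fin.succ 0)) 1 = v 0 := by simp
      have e2 : (fun k : Fin n =>
          (v ∘ Equiv.swap (Fin.castSucc (0 : Fin (n + 1))) (Fin.succ 0)) k.succ.succ)
          = fun k => v k.succ.succ := by
        ext k
        simp only [Function.comp_apply]
        rw [Equiv.swap_apply_of_ne_of_ne] <;> simp [Fin.ext_iff]
      rw [e0, e1, e2, hsymm.eq]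
    | succ j =>
      have hf' : ContDiff ℝ (n + 1 : ℕ) f := hf.of_le (by norm_cast; omega)
      have hdiff : DifferentiableAt ℝ (iteratedFDeriv ℝ (n + 1) f) x :=
        (hf.differentiable_iteratedFDeriv (by norm_cast; omega)) x
      have e0 : (v ∘ Equiv.swap j.succ.castSucc j.succ.succ) 0 = v 0 := by
        simp only [Function.comp_apply]
        rw [Equiv.swap_apply_of_ne_of_ne] <;> simp [Fin.ext_iff]
      have e1 : Fin.tail (v ∘ Equiv.swap j.succ.castSucc j.succ.succ)
          = Fin.tail v ∘ Equiv.swap j.castSucc j.succ := by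
        ext k
        simp only [Fin.tail, Function.comp_apply, ← Fin.succ_castSucc]
        rw [(Fin.succ_injective _).swap_apply]
      rw [iteratedFDeriv_succ_apply_left, iteratedFDeriv_succ_apply_left, e0, e1,
        ← fderiv_continuousMultilinear_apply_const_apply hdiff,
        ← fderiv_continuousMultilinear_apply_const_apply hdiff]
      simp_rw [ih hf' j]

theorem ContDiff.iteratedFDeriv_comp_perm {E F : Type*} [NormedAddCommGroup E] [NormedSpace ℝ E]
    [NormedAddCommGroup F] [NormedSpace ℝ F] {f : E → F} {n : ℕ} (hf : ContDiff ℝ n f)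
    (x : E) (v : Fin n → E) (σ : Equiv.Perm (Fin n)) :
    iteratedFDeriv ℝ n f x (v ∘ σ) = iteratedFDeriv ℝ n f x v := by
  cases n with
  | zero => exact congrArg _ (Subsingleton.elim _ _)
  | succ n =>
    have hσ : σ ∈ Submonoid.closure
        (Set.range fun i : Fin n => Equiv.swap i.castSucc i.succ) := by
      rw [Equiv.Perm.mclosure_swap_castSucc_succ]; trivial
    induction hσ using Submonoid.closure_induction generalizing v with
    | mem σ h => obtain ⟨i, rfl⟩ := h; exact hf.iteratedFDeriv_comp_swap i x v
    | one => rfl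
    | mul σ τ _ _ hσ hτ => rw [Equiv.Perm.coe_mul, ← Function.comp_assoc, hτ, hσ]

/-- Polarization: a symmetric multilinear map is determined by its values on the diagonal. -/
theorem MultilinearMap.sum_powerset_diagonal {R M N ι : Type*} [CommRing R] [AddCommGroup M]
    [Module R M] [AddCommGroup N] [Module R N] [Fintype ι] [DecidableEq ι]
    (f : MultilinearMap R (fun _ : ι => M) N)
    (hf : ∀ (v : ι → M) (σ : Equiv.Perm ι), f (v ∘ σ) = f v) (v : ι → M) :
    ∑ s : Finset ι, (-1 : R) ^ s.card • f (fun _ => ∑ i ∈ s, v i)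
      = ((-1 : R) ^ Fintype.card ι * (Fintype.card ι).factorial) • f v := by
  have hexp (s : Finset ι) : f (fun _ => ∑ i ∈ s, v i)
      = ∑ τ : ι → ι, if Finset.univ.image τ ⊆ s then f (v ∘ τ) else 0 := by
    rw [f.map_sum_finset (fun _ i => v i) (fun _ => s), ← Finset.sum_filter]
    refine Finset.sum_congr ?_ fun _ _ => rfl
    ext τ
    simp [Fintype.mem_piFinset, Finset.subset_iff]
  have hinner (t : Finset ι) : ∑ s : Finset ι, (if t ⊆ s then (-1 : R) ^ s.card else 0)
      = if t = Finset.univ then (-1 : R) ^ Fintype.card ι else 0 := by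
    have hset : Finset.univ.filter (fun s : Finset ι => t ⊆ s)
        = (tᶜ).powerset.image (fun u => t ∪ u) := by
      ext s
      simp only [Finset.mem_filter, Finset.mem_univ, true_and, Finset.mem_image,
        Finset.mem_powerset]
      constructor
      · intro h
        exact ⟨s \ t, by intro a; simp, Finset.union_sdiff_of_subset h⟩
      · rintro ⟨u, -, rfl⟩
        exact Finset.subset_union_left
    have hinj : Set.InjOn (fun u => t ∪ u) ((tᶜ).powerset : Set (Finset ι)) := by
      intro a ha b hb hab
      simp only [Finset.coe_powerset, Set.mem_preimage, Set.mem_powerset_iff,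
        Finset.coe_subset] at ha hb
      ext i
      have h1 := Finset.ext_iff.1 hab i
      have h2 := @ha i
      have h3 := @hb i
      simp only [Finset.mem_union, Finset.mem_compl] at h1 h2 h3
      tauto
    rw [← Finset.sum_filter, hset, Finset.sum_image hinj]
    have hcard : ∀ u ∈ (tᶜ).powerset, (-1 : R) ^ (t ∪ u).card
        = (-1) ^ t.card * (((-1 : ℤ) ^ u.card : ℤ) : R) := by
      intro u hu
      have hd : Disjoint t u :=
        Finset.disjoint_left.2 fun i hi hu' => by
          have := Finset.mem_powerset.1 hu hu'
          simp_all
      rw [Finset.card_union_of_disjoint hd, pow_add]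
      push_cast
      rfl
    rw [Finset.sum_congr rfl hcard, ← Finset.mul_sum, ← Int.cast_sum,
      Finset.sum_powerset_neg_one_pow_card]
    by_cases ht : t = Finset.univ
    · simp [ht]
    · simp [ht]
  simp_rw [hexp, Finset.smul_sum]
  rw [Finset.sum_comm]
  have hτ (τ : ι → ι) : ∑ s : Finset ι,
      (-1 : R) ^ s.card • (if Finset.univ.image τ ⊆ s then f (v ∘ τ) else 0)
      = if Function.Bijective τ then (-1 : R) ^ Fintype.card ι • f v else 0 := by
    have : ∀ s : Finset ι,
        (-1 : R) ^ s.card • (if Finset.univ.image τ ⊆ s then f (v ∘ τ) else 0)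
        = (if Finset.univ.image τ ⊆ s then (-1 : R) ^ s.card else 0) • f (v ∘ τ) := by
      intro s; split_ifs <;> simp
    simp_rw [this]
    rw [← Finset.sum_smul, hinner]
    have hiff : Finset.univ.image τ = Finset.univ ↔ Function.Bijective τ := by
      rw [Finset.eq_univ_iff_forall, ← Finite.surjective_iff_bijective]
      simp [Function.Surjective]
    by_cases hb : Function.Bijective τ
    · rw [if_pos (hiff.2 hb), if_pos hb]
      congr 1
      exact hf v (Equiv.ofBijective τ hb)
    · rw [if_neg (mt hiff.1 hb), if_neg hb, zero_smul]
  simp_rw [hτ]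
  rw [← Finset.sum_filter, Finset.sum_const]
  have : (Finset.univ.filter fun τ : ι → ι => Function.Bijective τ).card
      = (Fintype.card ι).factorial := by
    rw [← Fintype.card_perm, ← Fintype.card_subtype]
    exact Fintype.card_congr (Equiv.ofBijective
      (fun τ : {τ : ι → ι // Function.Bijective τ} => Equiv.ofBijective τ.1 τ.2)
      ⟨fun a b h => Subtype.ext (congrArg (fun e : Equiv.Perm ι => (e : ι → ι)) h),
        fun σ => ⟨⟨σ, σ.bijective⟩, by ext; rfl⟩⟩)
  rw [this, mul_smul, ← Nat.cast_smul_eq_nsmul R, smul_comm]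

theorem MultilinearMap.diagonal_eq_sum_single {d : ℕ} {ι : Type*} [Fintype ι] [DecidableEq ι]
    (f : MultilinearMap ℝ (fun _ : ι => EuclideanSpace ℝ (Fin d)) ℝ)
    (v : EuclideanSpace ℝ (Fin d)) :
    f (fun _ => v)
      = ∑ τ : ι → Fin d, (∏ k, v (τ k)) * f (fun k => EuclideanSpace.single (τ k) 1) := by
  have hv : v = ∑ j, v j • EuclideanSpace.single j (1 : ℝ) := by
    ext k
    simp [Finset.sum_apply, Pi.single_apply]
  conv_lhs => rw [hv]
  rw [f.map_sum (fun _ j => v j • EuclideanSpace.single j (1 : ℝ))]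
  refine Finset.sum_congr rfl fun τ _ => ?_
  rw [f.map_smul_univ (fun k => v (τ k)) fun k => EuclideanSpace.single (τ k) (1 : ℝ), smul_eq_mul]

/-- An integrable function whose integral along every line of direction `v ≠ 0` vanishes
has zero integral. -/
theorem MeasureTheory.integral_eq_zero_of_forall_line {E : Type*} [NormedAddCommGroup E]
    [NormedSpace ℝ E] [FiniteDimensional ℝ E] [MeasurableSpace E] [BorelSpace E]
    {μ : Measure E} [μ.IsAddHaarMeasure] {φ : E → ℝ} (hφ : Integrable φ μ) {v : E} (hv : v ≠ 0)
    (hline : ∀ x, ∫ t : ℝ, φ (x + t • v) = 0) : ∫ x, φ x ∂μ = 0 := by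
  have : Nontrivial E := nontrivial_iff.2 ⟨v, 0, hv⟩
  let E' := Fin (Module.finrank ℝ E - 1) → ℝ
  obtain ⟨L, hL⟩ : ∃ L : E ≃L[ℝ] (E' × ℝ), L v = (0, 1) := by
    have hfin : Module.finrank ℝ (E' × ℝ) = Module.finrank ℝ E := by
      simpa [E'] using Nat.sub_add_cancel Module.finrank_pos
    have L₀ : E ≃L[ℝ] (E' × ℝ) := (ContinuousLinearEquiv.ofFinrankEq hfin).symm
    obtain ⟨M, hM⟩ : ∃ M : (E' × ℝ) ≃L[ℝ] (E' × ℝ), M (L₀ v) = (0, 1) := by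
      apply SeparatingDual.exists_continuousLinearEquiv_apply_eq
      · simpa using hv
      · simp
    exact ⟨L₀.trans M, by simp [hM]⟩
  have hLv : L.symm (0, 1) = v := by rw [← hL, L.symm_apply_apply]
  have L_emb : MeasurableEmbedding L := L.toHomeomorph.measurableEmbedding
  let ν := μ.map L
  have : ν.IsAddHaarMeasure := L.isAddHaarMeasure_map μ
  let ρ : Measure E' := Measure.addHaar
  have hφν : Integrable (fun y => φ (L.symm y)) ν := by
    rw [L_emb.integrable_map_iff]
    simpa [Function.comp_def] using hφ
  have hint : ∫ y, φ (L.symm y) ∂ν = ∫ x, φ x ∂μ := by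
    simp only [ν, L_emb.integral_map, L.symm_apply_apply]
  have A : ρ.prod volume = (Measure.addHaarScalarFactor (ρ.prod volume) ν) • ν :=
    Measure.isAddLeftInvariant_eq_smul _ _
  have hφρ : Integrable (fun y => φ (L.symm y)) (ρ.prod volume) := by
    rw [A]; exact hφν.smul_measure_nnreal
  have hzero : ∫ y, φ (L.symm y) ∂(ρ.prod volume) = 0 := by
    rw [integral_prod _ hφρ]
    refine integral_eq_zero_of_ae (Eventually.of_forall fun y => ?_)
    have hsplit (t : ℝ) : L.symm (y, t) = L.symm (y, 0) + t • v := by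
      rw [← hLv, ← map_smul, ← map_add]
      simp
    exact (integral_congr_ae (Eventually.of_forall fun t => congrArg φ (hsplit t))).trans (hline _)
  rw [← hint, Measure.isAddLeftInvariant_eq_smul ν (ρ.prod volume)]
  simp [hzero]

/-- On a set where a differentiable real function vanishes, so does its derivative, outside a
null set. -/
theorem ae_deriv_eq_zero_of_eqOn_zero {H H' : ℝ → ℝ} (hH : ∀ t, HasDerivAt H (H' t) t)
    {Z : Set ℝ} (hZ : ∀ t ∈ Z, H t = 0) : ∀ᵐ t, t ∈ Z → H' t = 0 := by
  have hc : {t ∈ Z | nhdsWithin t (Z ∩ Set.Ioi t) = ⊥}.Countable :=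
    countable_setOfPred_isolated_right_within
  filter_upwards [hc.ae_notMem volume] with t ht htZ
  have hne : (nhdsWithin t (Z ∩ Set.Ioi t)).NeBot := ⟨fun h => ht ⟨htZ, h⟩⟩
  have hsub : Z ∩ Set.Ioi t ⊆ {t}ᶜ := fun s hs => ne_of_gt hs.2
  have h1 : Tendsto (slope H t) (nhdsWithin t (Z ∩ Set.Ioi t)) (nhds (H' t)) :=
    (hasDerivAt_iff_tendsto_slope.1 (hH t)).mono_left (nhdsWithin_mono _ hsub)
  refine tendsto_nhds_unique h1 (tendsto_const_nhds.congr' ?_)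
  filter_upwards [self_mem_nhdsWithin] with s hs
  simp [slope_def_field, hZ s hs.1, hZ t htZ]

theorem integral_indicator_sub_eq_zero {H a b : ℝ → ℝ} (hH : ∀ t, HasDerivAt H (a t - b t) t)
    {Z : Set ℝ} (hZ : ∀ t ∈ Z, H t = 0) (hb : ∀ t ∈ Z, b t = 0)
    (hbot : Tendsto H atBot (nhds 0)) (htop : Tendsto H atTop (nhds 0)) :
    ∫ t, (Zᶜ.indicator a t - b t) = 0 := by
  have hae : (fun t => Zᶜ.indicator a t - b t) =ᵐ[volume] fun t => a t - b t := by
    filter_upwards [ae_deriv_eq_zero_of_eqOn_zero hH hZ] with t ht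
    by_cases htZ : t ∈ Z
    · rw [ht htZ, hb t htZ, Set.indicator_of_notMem (by simpa using htZ), sub_zero]
    · simp [htZ]
  rw [integral_congr_ae hae]
  by_cases hi : Integrable fun t => a t - b t
  · simpa using integral_of_hasDerivAt_of_tendsto hH hi hbot htop
  · exact integral_undef hi

theorem tendsto_add_smul_cocompact {E : Type*} [NormedAddCommGroup E] [NormedSpace ℝ E]
    (x : E) {v : E} (hv : v ≠ 0) :
    Tendsto (fun t : ℝ => x + t • v) (cocompact ℝ) (cocompact E) :=
  ((Homeomorph.addLeft x).isClosedEmbedding.comp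
    (isClosedEmbedding_smul_left hv)).tendsto_cocompact

theorem hasDerivAt_iteratedFDeriv_line {E : Type*} [NormedAddCommGroup E] [NormedSpace ℝ E]
    {f : E → ℝ} {m k : ℕ} (hf : ContDiff ℝ m f) (hk : k < m) (x v : E) (t : ℝ) :
    HasDerivAt (fun s : ℝ => iteratedFDeriv ℝ k f (x + s • v) fun _ => v)
      (iteratedFDeriv ℝ (k + 1) f (x + t • v) fun _ => v) t := by
  have hd : DifferentiableAt ℝ (iteratedFDeriv ℝ k f) (x + t • v) :=
    (hf.differentiable_iteratedFDeriv (by exact_mod_cast hk)) _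
  have hd' : DifferentiableAt ℝ (fun y => iteratedFDeriv ℝ k f y fun _ => v) (x + t • v) :=
    hd.continuousMultilinear_apply_const _
  have hline : HasDerivAt (fun s : ℝ => x + s • v) v t := by
    simpa using ((hasDerivAt_id t).smul_const v).const_add x
  convert! hd'.hasFDerivAt.comp_hasDerivAt t hline using 1
  rw [fderiv_continuousMultilinear_apply_const_apply hd, iteratedFDeriv_succ_apply_left]
  rfl

theorem scoreFun_mul_self {d : ℕ} (p : EuclideanSpace ℝ (Fin d) → ℝ) (k : ℕ)
    (x : EuclideanSpace ℝ (Fin d)) (idx : Fin k → Fin d) :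
    scoreFun p k x idx * p x = (Function.support p).indicator (fun y => (-1 : ℝ) ^ k *
      iteratedFDeriv ℝ k p y (fun j => EuclideanSpace.single (idx j) 1)) x := by
  by_cases hx : p x = 0
  · simp [hx]
  · rw [Set.indicator_of_mem (by simpa using hx), scoreFun, div_mul_cancel₀ _ hx]

/-- A weighted score that vanishes on the boundary of the support comes from a weighted derivative
of the density that vanishes at every zero of the density. -/
theorem mul_iteratedFDeriv_eq_zero_of_tendsto_frontier {d m k : ℕ}
    {p q : EuclideanSpace ℝ (Fin d) → ℝ} (hp : ContDiff ℝ m p) (hk : k ≤ m) (hq : Continuous q)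
    (idx : Fin k → Fin d)
    (hfr : ∀ z ∈ frontier (Function.support p),
      Tendsto (fun x => q x * scoreFun p k x idx * p x) (nhds z) (nhds 0))
    {x : EuclideanSpace ℝ (Fin d)} (hx : p x = 0) :
    q x * iteratedFDeriv ℝ k p x (fun j => EuclideanSpace.single (idx j) 1) = 0 := by
  have hcont : Continuous fun y =>
      q y * iteratedFDeriv ℝ k p y (fun j => EuclideanSpace.single (idx j) 1) :=
    hq.mul ((hp.continuous_iteratedFDeriv (by exact_mod_cast hk)).eval_const _)
  by_cases hcl : x ∈ closure (Function.support p)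
  · have hopen : IsOpen (Function.support p) := hp.continuous.isOpen_support
    have hxf : x ∈ frontier (Function.support p) := by
      rw [hopen.frontier_eq]
      exact ⟨hcl, by simpa using hx⟩
    have hne : (nhdsWithin x (Function.support p)).NeBot := mem_closure_iff_nhdsWithin_neBot.1 hcl
    have h0 := (((hfr x hxf).mono_left
      (nhdsWithin_le_nhds (s := Function.support p))).const_mul ((-1 : ℝ) ^ k))
    rw [mul_zero] at h0
    refine tendsto_nhds_unique (hcont.continuousAt.mono_left nhdsWithin_le_nhds) (h0.congr' ?_)
    filter_upwards [self_mem_nhdsWithin] with y hy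
    rw [mul_assoc (q y), scoreFun_mul_self, Set.indicator_of_mem hy, mul_left_comm,
      ← mul_assoc ((-1 : ℝ) ^ k), ← mul_pow]
    simp
  · have : iteratedFDeriv ℝ k p x = 0 := by
      by_contra h
      exact hcl (support_iteratedFDeriv_subset k h)
    simp [this]

theorem tendsto_mul_iteratedFDeriv_cocompact {d m k : ℕ}
    {p q : EuclideanSpace ℝ (Fin d) → ℝ} (hp : ContDiff ℝ m p) (hk : k ≤ m) (hq : Continuous q)
    (idx : Fin k → Fin d)
    (hfr : ∀ z ∈ frontier (Function.support p),
      Tendsto (fun x => q x * scoreFun p k x idx * p x) (nhds z) (nhds 0))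
    (hinf : Tendsto (fun x => q x * scoreFun p k x idx * p x) (cocompact _) (nhds 0)) :
    Tendsto (fun x => q x * iteratedFDeriv ℝ k p x (fun j => EuclideanSpace.single (idx j) 1))
      (cocompact _) (nhds 0) := by
  have h0 := hinf.const_mul ((-1 : ℝ) ^ k)
  rw [mul_zero] at h0
  refine h0.congr fun y => ?_
  by_cases hy : p y = 0
  · rw [mul_iteratedFDeriv_eq_zero_of_tendsto_frontier hp hk hq idx hfr hy, hy]
    simp
  · rw [mul_assoc (q y), scoreFun_mul_self, Set.indicator_of_mem (by simpa using hy),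
      mul_left_comm, ← mul_assoc ((-1 : ℝ) ^ k), ← mul_pow]
    simp

theorem iteratedFDeriv_mul_iteratedFDeriv_diagonal {d i k : ℕ}
    (g p : EuclideanSpace ℝ (Fin d) → ℝ) (x v : EuclideanSpace ℝ (Fin d)) :
    iteratedFDeriv ℝ i g x (fun _ => v) * iteratedFDeriv ℝ k p x (fun _ => v)
      = ∑ τ : Fin i → Fin d, ∑ τ' : Fin k → Fin d, ((∏ l, v (τ l)) * ∏ l, v (τ' l)) *
        (iteratedFDeriv ℝ i g x (fun l => EuclideanSpace.single (τ l) 1)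
          * iteratedFDeriv ℝ k p x (fun l => EuclideanSpace.single (τ' l) 1)) := by
  have hg := (iteratedFDeriv ℝ i g x).toMultilinearMap.diagonal_eq_sum_single v
  have hp := (iteratedFDeriv ℝ k p x).toMultilinearMap.diagonal_eq_sum_single v
  simp only [ContinuousMultilinearMap.coe_coe] at hg hp
  rw [hg, hp, Finset.sum_mul_sum]
  refine Finset.sum_congr rfl fun τ _ => Finset.sum_congr rfl fun τ' _ => by ring

/-- The alternating sum of products of iterated derivatives telescopes when differentiated. -/
theorem hasDerivAt_alternating_sum {P Q : ℕ → ℝ → ℝ} {m : ℕ} {t : ℝ}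
    (hP : ∀ k < m, HasDerivAt (P k) (P (k + 1) t) t)
    (hQ : ∀ k < m, HasDerivAt (Q k) (Q (k + 1) t) t) :
    HasDerivAt (fun s => ∑ i ∈ Finset.range m, (-1 : ℝ) ^ i * (P i s * Q (m - i - 1) s))
      (P 0 t * Q m t - (-1 : ℝ) ^ m * (P m t * Q 0 t)) t := by
  let c : ℕ → ℝ := fun i => (-1 : ℝ) ^ i * (P i t * Q (m - i) t)
  have hsum : HasDerivAt
      (fun s => ∑ i ∈ Finset.range m, (-1 : ℝ) ^ i * (P i s * Q (m - i - 1) s))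
      (∑ i ∈ Finset.range m, (c i - c (i + 1))) t := by
    refine HasDerivAt.fun_sum fun i hi => ?_
    have hi' : i < m := Finset.mem_range.1 hi
    have hsub : m - i = m - i - 1 + 1 := by omega
    have hc : c i - c (i + 1) = (-1 : ℝ) ^ i *
        (P (i + 1) t * Q (m - i - 1) t + P i t * Q (m - i - 1 + 1) t) := by
      simp only [c, ← Nat.sub_sub]
      rw [← hsub]
      ring
    rw [hc]
    exact ((hP i hi').mul (hQ (m - i - 1) (by omega))).const_mul _
  rw [Finset.sum_range_sub'] at hsum
  simpa [c] using hsum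

theorem hasDerivAt_alternating_sum_line {E : Type*} [NormedAddCommGroup E] [NormedSpace ℝ E]
    {g p : E → ℝ} {m : ℕ} (hg : ContDiff ℝ m g) (hp : ContDiff ℝ m p) (x v : E) (t : ℝ) :
    HasDerivAt (fun s : ℝ => ∑ i ∈ Finset.range m, (-1 : ℝ) ^ i *
        (iteratedFDeriv ℝ i g (x + s • v) (fun _ => v)
          * iteratedFDeriv ℝ (m - i - 1) p (x + s • v) fun _ => v))
      (g (x + t • v) * iteratedFDeriv ℝ m p (x + t • v) (fun _ => v)
        - (-1 : ℝ) ^ m * (iteratedFDeriv ℝ m g (x + t • v) (fun _ => v) * p (x + t • v))) t :=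
  hasDerivAt_alternating_sum
    (P := fun k s => iteratedFDeriv ℝ k g (x + s • v) fun _ => v)
    (Q := fun k s => iteratedFDeriv ℝ k p (x + s • v) fun _ => v)
    (fun _ hk => hasDerivAt_iteratedFDeriv_line hg hk x v t)
    (fun _ hk => hasDerivAt_iteratedFDeriv_line hp hk x v t)

/-- The pointwise difference of the two integrands of the Stein identity, as a multilinear map. -/
noncomputable def steinDefect {d : ℕ} (m : ℕ) (g p : EuclideanSpace ℝ (Fin d) → ℝ)
    (x : EuclideanSpace ℝ (Fin d)) :
    MultilinearMap ℝ (fun _ : Fin m => EuclideanSpace ℝ (Fin d)) ℝ :=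
  ((-1 : ℝ) ^ m * (Function.support p).indicator g x) •
      (iteratedFDeriv ℝ m p x).toMultilinearMap
    - p x • (iteratedFDeriv ℝ m g x).toMultilinearMap

theorem steinDefect_apply {d m : ℕ} (g p : EuclideanSpace ℝ (Fin d) → ℝ)
    (x : EuclideanSpace ℝ (Fin d)) (w : Fin m → EuclideanSpace ℝ (Fin d)) :
    steinDefect m g p x w = (-1 : ℝ) ^ m * (Function.support p).indicator g x *
      iteratedFDeriv ℝ m p x w - p x * iteratedFDeriv ℝ m g x w := rfl

theorem steinDefect_single {d m : ℕ} (g p : EuclideanSpace ℝ (Fin d) → ℝ)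
    (x : EuclideanSpace ℝ (Fin d)) (idx : Fin m → Fin d) :
    steinDefect m g p x (fun k => EuclideanSpace.single (idx k) 1)
      = g x * scoreFun p m x idx * p x
        - iteratedFDeriv ℝ m g x (fun k => EuclideanSpace.single (idx k) 1) * p x := by
  rw [steinDefect_apply, mul_assoc (g x), scoreFun_mul_self]
  by_cases hx : x ∈ Function.support p
  · simp only [Set.indicator_of_mem hx]; ring
  · simp only [Set.indicator_of_notMem hx]; ring

theorem integral_steinDefect_diagonal_eq_zero {d m : ℕ}
    {g p : EuclideanSpace ℝ (Fin d) → ℝ} (hm : m ≠ 0)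
    (hp : ContDiff ℝ m p) (hg : ContDiff ℝ m g)
    (hfr : ∀ i < m, ∀ (τ : Fin i → Fin d) (τ' : Fin (m - i - 1) → Fin d),
      ∀ z ∈ frontier (Function.support p),
      Tendsto (fun x => iteratedFDeriv ℝ i g x (fun k => EuclideanSpace.single (τ k) 1)
        * scoreFun p (m - i - 1) x τ' * p x) (nhds z) (nhds 0))
    (hinf : ∀ i < m, ∀ (τ : Fin i → Fin d) (τ' : Fin (m - i - 1) → Fin d),
      Tendsto (fun x => iteratedFDeriv ℝ i g x (fun k => EuclideanSpace.single (τ k) 1)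
        * scoreFun p (m - i - 1) x τ' * p x) (cocompact _) (nhds 0))
    (v : EuclideanSpace ℝ (Fin d)) (hint : Integrable fun x => steinDefect m g p x fun _ => v) :
    ∫ x, steinDefect m g p x (fun _ => v) = 0 := by
  rcases eq_or_ne v 0 with rfl | hv
  · have h (x) : steinDefect m g p x (fun _ => 0) = 0 :=
      (steinDefect m g p x).map_coord_zero ⟨0, Nat.pos_of_ne_zero hm⟩ rfl
    simp [h]
  refine integral_eq_zero_of_forall_line hint hv fun x => ?_
  have hgc (i) (hi : i < m) (τ : Fin i → Fin d) : Continuous fun y =>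
      iteratedFDeriv ℝ i g y (fun k => EuclideanSpace.single (τ k) 1) :=
    (hg.continuous_iteratedFDeriv (by exact_mod_cast hi.le)).eval_const _
  have hzero (i) (hi : i < m) (y) (hy : p y = 0) : iteratedFDeriv ℝ i g y (fun _ => v)
      * iteratedFDeriv ℝ (m - i - 1) p y (fun _ => v) = 0 := by
    rw [iteratedFDeriv_mul_iteratedFDeriv_diagonal]
    refine Finset.sum_eq_zero fun τ _ => Finset.sum_eq_zero fun τ' _ => ?_
    rw [mul_iteratedFDeriv_eq_zero_of_tendsto_frontier hp (by omega) (hgc i hi τ) τ'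
      (hfr i hi τ τ') hy, mul_zero]
  have htend (i) (hi : i < m) : Tendsto (fun y => iteratedFDeriv ℝ i g y (fun _ => v)
      * iteratedFDeriv ℝ (m - i - 1) p y (fun _ => v)) (cocompact _) (nhds 0) := by
    simp_rw [iteratedFDeriv_mul_iteratedFDeriv_diagonal]
    rw [← Finset.sum_const_zero (s := (Finset.univ : Finset (Fin i → Fin d)))]
    refine tendsto_finsetSum _ fun τ _ => ?_
    rw [← Finset.sum_const_zero (s := (Finset.univ : Finset (Fin (m - i - 1) → Fin d)))]
    refine tendsto_finsetSum _ fun τ' _ => ?_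
    simpa using (tendsto_mul_iteratedFDeriv_cocompact hp (by omega) (hgc i hi τ) τ'
      (hfr i hi τ τ') (hinf i hi τ τ')).const_mul ((∏ l, v (τ l)) * ∏ l, v (τ' l))
  have hH : Tendsto (fun s : ℝ => ∑ i ∈ Finset.range m, (-1 : ℝ) ^ i *
      (iteratedFDeriv ℝ i g (x + s • v) (fun _ => v)
        * iteratedFDeriv ℝ (m - i - 1) p (x + s • v) fun _ => v)) (cocompact ℝ) (nhds 0) := by
    rw [← Finset.sum_const_zero (s := Finset.range m)]
    refine tendsto_finsetSum _ fun i hi => ?_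
    simpa using ((htend i (Finset.mem_range.1 hi)).comp
      (tendsto_add_smul_cocompact x hv)).const_mul ((-1 : ℝ) ^ i)
  have hline := integral_indicator_sub_eq_zero (Z := {t | p (x + t • v) = 0})
    (hasDerivAt_alternating_sum_line hg hp x v)
    (fun t ht => Finset.sum_eq_zero fun i hi => by
      rw [hzero i (Finset.mem_range.1 hi) _ ht, mul_zero])
    (fun t ht => by rw [show p (x + t • v) = 0 from ht]; ring)
    (hH.mono_left atBot_le_cocompact) (hH.mono_left atTop_le_cocompact)
  rw [← mul_zero ((-1 : ℝ) ^ m), ← hline, ← integral_const_mul]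
  congr 1
  ext t
  rw [steinDefect_apply, mul_sub, ← mul_assoc ((-1 : ℝ) ^ m) ((-1 : ℝ) ^ m), ← mul_pow]
  by_cases ht : p (x + t • v) = 0
  · simp [Set.indicator, ht]
  · simp only [Set.indicator, Function.mem_support, Set.mem_compl_iff, Set.mem_ofPred_eq, ne_eq, ht,
      not_false_eq_true, if_true]
    norm_num
    ring

/-- **Higher order Stein identity** (score functions yield higher order differential
operators).  Let `x ∈ ℝ^{dx}` have density `p` whose `m`-th order score function
`S_m(x) = (−1)^m ∇ₓ^{(m)} p(x)/p(x)` exists, and let `G : ℝ^{dx} → ⊗^r ℝ^{dy}` be an `m` times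
continuously differentiable tensor-valued function such that for each `i ∈ {0,…,m−1}` every
entry of `∇ₓ^{(i)} G(x) ⊗ S_{m−i−1}(x) · p(x)` tends to zero on the boundary of the support of
`p` (including at infinity), and all the expectations involved exist.  Then, entrywise,
`E[G(x) ⊗ S_m(x)] = E[∇ₓ^{(m)} G(x)]`. -/
theorem higher_order_stein_identity
    (dx dy r m : ℕ)
    (p : EuclideanSpace ℝ (Fin dx) → ℝ)
    (G : EuclideanSpace ℝ (Fin dx) → (Fin r → Fin dy) → ℝ)
    -- `p` is a probability density function
    (hp_nonneg : ∀ x, 0 ≤ p x)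
    (hp_mass : ∫ x, p x = 1)
    -- the `m`-th order score function exists
    (hp_smooth : ContDiff ℝ m p)
    -- `G` is `m` times continuously differentiable (entrywise)
    (hG : ∀ a, ContDiff ℝ m fun x => G x a)
    -- boundary conditions : for each `i < m`, every entry of
    -- `∇ₓ^{(i)} G(x) ⊗ S_{m−i−1}(x) · p(x)` vanishes on the boundary of the support of `p` ...
    (hbound_frontier : ∀ i < m, ∀ (a : Fin r → Fin dy)
      (idx₁ : Fin i → Fin dx) (idx₂ : Fin (m - i - 1) → Fin dx),
      ∀ z ∈ frontier (Function.support p),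
      Tendsto (fun x =>
          iteratedFDeriv ℝ i (fun y => G y a) x (fun k => EuclideanSpace.single (idx₁ k) 1)
            * scoreFun p (m - i - 1) x idx₂ * p x)
        (nhds z) (nhds 0))
    -- ... and at infinity
    (hbound_infty : ∀ i < m, ∀ (a : Fin r → Fin dy)
      (idx₁ : Fin i → Fin dx) (idx₂ : Fin (m - i - 1) → Fin dx),
      Tendsto (fun x =>
          iteratedFDeriv ℝ i (fun y => G y a) x (fun k => EuclideanSpace.single (idx₁ k) 1)
            * scoreFun p (m - i - 1) x idx₂ * p x)
        (cocompact _) (nhds 0))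
    -- the expectations below exist
    (hint₁ : ∀ (a : Fin r → Fin dy) (idx : Fin m → Fin dx),
      Integrable fun x => G x a * scoreFun p m x idx * p x)
    (hint₂ : ∀ (a : Fin r → Fin dy) (idx : Fin m → Fin dx),
      Integrable fun x =>
        iteratedFDeriv ℝ m (fun y => G y a) x (fun k => EuclideanSpace.single (idx k) 1) * p x) :
    -- conclusion : `E[G(x) ⊗ S_m(x)] = E[∇ₓ^{(m)} G(x)]`, entrywise
    ∀ (a : Fin r → Fin dy) (idx : Fin m → Fin dx),
      ∫ x, G x a * scoreFun p m x idx * p x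
        = ∫ x, iteratedFDeriv ℝ m (fun y => G y a) x
            (fun k => EuclideanSpace.single (idx k) 1) * p x := by
  intro a idx
  set g := fun y => G y a
  rcases eq_or_ne m 0 with rfl | hm
  · refine integral_congr_ae (Eventually.of_forall fun x => ?_)
    by_cases hx : p x = 0
    · simp [hx]
    · simp [scoreFun, g, hx]
  have hsingle (τ : Fin m → Fin dx) : Integrable fun x =>
      steinDefect m g p x fun k => EuclideanSpace.single (τ k) 1 := by
    simp_rw [steinDefect_single]
    exact (hint₁ a τ).sub (hint₂ a τ)
  have hdiag (v) : Integrable fun x => steinDefect m g p x fun _ => v := by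
    simp_rw [MultilinearMap.diagonal_eq_sum_single _ v]
    exact integrable_finsetSum _ fun τ _ => (hsingle τ).const_mul _
  have hsymm (x) (w : Fin m → EuclideanSpace ℝ (Fin dx)) (σ : Equiv.Perm (Fin m)) :
      steinDefect m g p x (w ∘ σ) = steinDefect m g p x w := by
    rw [steinDefect_apply, steinDefect_apply, hp_smooth.iteratedFDeriv_comp_perm,
      (hG a).iteratedFDeriv_comp_perm]
  have hzero : ∫ x, steinDefect m g p x (fun k => EuclideanSpace.single (idx k) 1) = 0 := by
    have hc : (-1 : ℝ) ^ m * m.factorial ≠ 0 := 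
      mul_ne_zero (by simp) (by positivity)
    refine (mul_eq_zero.1 ?_).resolve_left hc
    rw [← integral_const_mul]
    have hpol (x) := (steinDefect m g p x).sum_powerset_diagonal (hsymm x)
      fun k => EuclideanSpace.single (idx k) 1
    simp only [Fintype.card_fin, smul_eq_mul] at hpol
    simp_rw [← hpol]
    rw [integral_finsetSum _ fun s _ => (hdiag _).const_mul _]
    refine Finset.sum_eq_zero fun s _ => ?_
    rw [integral_const_mul, integral_steinDefect_diagonal_eq_zero hm hp_smooth (hG a)
      (fun i hi => hbound_frontier i hi a) (fun i hi => hbound_infty i hi a) _ (hdiag _), mul_zero]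
  simp_rw [steinDefect_single] at hzero
  rw [integral_sub (hint₁ a idx) (hint₂ a idx)] at hzero
  exact sub_eq_zero.1 hzero
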